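/- Let β ∈ (−1, 1), μ₊, μ₋ ∈ ℝ, q > 0, x < 0 and y > 0. Then ∫₀^∞ e^{−q t} · [ 2(1+β) e^{2 μ₊ y} ∫₀^∞ ∫₀^t h(τ; (1+β) b + y, μ₊) · h(t − τ; (1−β) b − x, −μ₋) dτ db ] dt = (2(1+β)/D(q)) · e^{(−μ₋ + √(μ₋² + 2q)) x} · e^{(μ₊ − √(μ₊² + 2q)) y}. -/

import Mathlib

open MeasureTheory Real Set Filter

/-- The auxiliary density `h(t; x, μ) = |x| / √(2π t³) · exp(−(x + μ t)² / (2t))`. -/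
noncomputable def h (t x μ : ℝ) : ℝ :=
  |x| / Real.sqrt (2 * Real.pi * t ^ 3) * Real.exp (-(x + μ * t) ^ 2 / (2 * t))

/-- `D(q) = (1+β)(μ₊ + √(2q+μ₊²)) + (1−β)(−μ₋ + √(2q+μ₋²))`. -/
noncomputable def D (β μp μm q : ℝ) : ℝ :=
  (1 + β) * (μp + Real.sqrt (2 * q + μp ^ 2)) + (1 - β) * (-μm + Real.sqrt (2 * q + μm ^ 2))

/-- If the derivative of `f` on `(a, ∞)` is nonnegative and `f` has limits at both ends, then the
derivative is integrable and its integral is the difference of the limits. -/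
lemma integral_Ioi_of_hasDerivAt_of_nonneg_of_tendsto {f f' : ℝ → ℝ} {a l m : ℝ}
    (hderiv : ∀ x ∈ Ioi a, HasDerivAt f (f' x) x) (f'pos : ∀ x ∈ Ioi a, 0 ≤ f' x)
    (hbot : Tendsto f (nhdsWithin a (Ioi a)) (nhds l)) (htop : Tendsto f atTop (nhds m)) :
    IntegrableOn f' (Ioi a) ∧ ∫ x in Ioi a, f' x = m - l := by
  classical
  have hcont : ContinuousWithinAt (Function.update f a l) (Ici a) a := by
    rw [continuousWithinAt_update_same]
    simpa using hbot
  have hd : ∀ x ∈ Ioi a, HasDerivAt (Function.update f a l) (f' x) x := fun x hx =>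
    (hderiv x hx).congr_of_eventuallyEq <| by
      filter_upwards [Ioi_mem_nhds hx] with z hz
      exact Function.update_of_ne (ne_of_gt hz) _ _
  have ht : Tendsto (Function.update f a l) atTop (nhds m) := htop.congr' <| by
    filter_upwards [Ioi_mem_atTop a] with z hz
    exact (Function.update_of_ne (ne_of_gt hz) _ _).symm
  refine ⟨integrableOn_Ioi_deriv_of_nonneg hcont hd f'pos ht, ?_⟩
  simpa using integral_Ioi_of_hasDerivAt_of_nonneg hcont hd f'pos ht

/-- The unnormalised Gaussian primitive. -/
noncomputable def gaussPrim (z : ℝ) : ℝ := ∫ u in (0 : ℝ)..z, exp (-(1 / 2) * u ^ 2)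

lemma hasDerivAt_gaussPrim (z : ℝ) : HasDerivAt gaussPrim (exp (-(1 / 2) * z ^ 2)) z := by
  have hc : Continuous fun u : ℝ => exp (-(1 / 2) * u ^ 2) := by fun_prop
  exact intervalIntegral.integral_hasDerivAt_right (hc.intervalIntegrable _ _)
    (hc.stronglyMeasurableAtFilter _ _) hc.continuousAt

lemma tendsto_gaussPrim_atTop : Tendsto gaussPrim atTop (nhds (√(2 * π) / 2)) := by
  have := intervalIntegral_tendsto_integral_Ioi 0
    (integrable_exp_neg_mul_sq (b := 1 / 2) (by norm_num)).integrableOn tendsto_id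
  rw [integral_gaussian_Ioi, show π / (1 / 2) = 2 * π by ring] at this
  exact this

lemma gaussPrim_neg (z : ℝ) : gaussPrim (-z) = -gaussPrim z := by
  unfold gaussPrim
  have := intervalIntegral.integral_comp_neg (a := 0) (b := -z)
    (fun u : ℝ => exp (-(1 / 2) * u ^ 2))
  simp only [neg_sq, neg_neg, neg_zero] at this
  rw [this, intervalIntegral.integral_symm]

lemma tendsto_gaussPrim_atBot : Tendsto gaussPrim atBot (nhds (-(√(2 * π) / 2))) := by
  have := (tendsto_gaussPrim_atTop.comp tendsto_neg_atBot_atTop).neg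
  refine this.congr fun z => ?_
  simp [gaussPrim_neg]

/-- A primitive in `t` of `√(2π) · h(t; x, 0) · exp(−l² t / 2)`, for `0 ≤ x`. -/
lemma hasDerivAt_hitting_primitive (x l : ℝ) {t : ℝ} (ht : 0 < t) :
    HasDerivAt (fun t => exp (-l * x) * gaussPrim (l * √t - x / √t)
        + exp (l * x) * gaussPrim (-l * √t - x / √t))
      (x / √(t ^ 3) * exp (-x ^ 2 / (2 * t) - l ^ 2 * t / 2)) t := by
  obtain ⟨s, hs, rfl⟩ : ∃ s : ℝ, 0 < s ∧ t = s ^ 2 :=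
    ⟨√t, sqrt_pos.2 ht, (sq_sqrt ht.le).symm⟩
  have hsq : √(s ^ 2) = s := sqrt_sq hs.le
  have hcu : √((s ^ 2) ^ 3) = s ^ 3 := by
    rw [show (s ^ 2) ^ 3 = (s ^ 3) ^ 2 by ring, sqrt_sq (by positivity)]
  have hr := hasDerivAt_sqrt ht.ne'
  have harg (c : ℝ) : HasDerivAt (fun t => c * √t - x / √t)
      (c / (2 * s) + x / (2 * s ^ 3)) (s ^ 2) := by
    have := (hr.const_mul c).sub ((hasDerivAt_const (s ^ 2) x).div hr (by rw [hsq]; exact hs.ne'))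
    refine this.congr_deriv ?_
    rw [hsq]; field_simp; ring
  have hG (c : ℝ) := ((hasDerivAt_gaussPrim _).comp (s ^ 2) (harg c)).const_mul (exp (-c * x))
  have hsum := (hG l).add (hG (-l))
  rw [neg_neg] at hsum
  refine hsum.congr_deriv ?_
  have he (c : ℝ) : exp (-c * x) * exp (-(1 / 2) * (c * s - x / s) ^ 2)
      = exp (-x ^ 2 / (2 * s ^ 2) - c ^ 2 * s ^ 2 / 2) := by
    rw [← exp_add]; congr 1; field_simp; ring
  have h1 := he l
  have h2 := he (-l)
  rw [neg_neg, neg_sq] at h2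
  rw [hcu, hsq, ← mul_assoc, ← mul_assoc, h1, h2]
  field_simp; ring

lemma laplace_hitting_driftless {x l : ℝ} (hx : 0 < x) (hl : 0 < l) :
    IntegrableOn (fun t => x / √(t ^ 3) * exp (-x ^ 2 / (2 * t) - l ^ 2 * t / 2)) (Ioi 0) ∧
      ∫ t in Ioi (0 : ℝ), x / √(t ^ 3) * exp (-x ^ 2 / (2 * t) - l ^ 2 * t / 2)
        = √(2 * π) * exp (-l * x) := by
  have hs0 : Tendsto (fun t : ℝ => √t) (nhdsWithin 0 (Ioi 0)) (nhdsWithin 0 (Ioi 0)) := by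
    refine tendsto_nhdsWithin_iff.2 ⟨?_, ?_⟩
    · simpa using (continuous_sqrt.tendsto 0).mono_left nhdsWithin_le_nhds
    · filter_upwards [self_mem_nhdsWithin] with t ht using sqrt_pos.2 ht
  have hbot (c : ℝ) : Tendsto (fun t => c * √t - x / √t) (nhdsWithin 0 (Ioi 0)) atBot := by
    have h1 : Tendsto (fun s : ℝ => c * s) (nhdsWithin 0 (Ioi 0)) (nhds (c * 0)) :=
      ((continuous_const_mul c).tendsto 0).mono_left nhdsWithin_le_nhds
    have h2 : Tendsto (fun s : ℝ => -(x / s)) (nhdsWithin 0 (Ioi 0)) atBot :=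
      tendsto_neg_atTop_atBot.comp (tendsto_inv_nhdsGT_zero.const_mul_atTop hx)
    simpa [sub_eq_add_neg] using! (h1.add_atBot h2).comp hs0
  have hdiv : Tendsto (fun t : ℝ => -(x / √t)) atTop (nhds (-0)) :=
    (tendsto_sqrt_atTop.const_div_atTop x).neg
  have htop : Tendsto (fun t => l * √t - x / √t) atTop atTop := by
    simpa [sub_eq_add_neg] using (tendsto_sqrt_atTop.const_mul_atTop hl).atTop_add hdiv
  have htop' : Tendsto (fun t => -l * √t - x / √t) atTop atBot := by
    simpa [sub_eq_add_neg] using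
      (tendsto_sqrt_atTop.const_mul_atTop_of_neg (neg_neg_of_pos hl)).atBot_add hdiv
  have key := integral_Ioi_of_hasDerivAt_of_nonneg_of_tendsto
    (fun t ht => hasDerivAt_hitting_primitive x l ht) (fun t ht => by positivity)
    (((tendsto_gaussPrim_atBot.comp (hbot l)).const_mul (exp (-l * x))).add
      ((tendsto_gaussPrim_atBot.comp (hbot (-l))).const_mul (exp (l * x))))
    (((tendsto_gaussPrim_atTop.comp htop).const_mul (exp (-l * x))).add
      ((tendsto_gaussPrim_atBot.comp htop').const_mul (exp (l * x))))
  refine ⟨key.1, key.2.trans ?_⟩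
  ring

lemma exp_mul_h_eq {x μ q t : ℝ} (hx : 0 < x) (hq : 0 < q) (ht : 0 < t) :
    exp (-q * t) * h t x μ = exp (-μ * x) / √(2 * π) *
      (x / √(t ^ 3) * exp (-x ^ 2 / (2 * t) - √(μ ^ 2 + 2 * q) ^ 2 * t / 2)) := by
  have he : exp (-q * t) * exp (-(x + μ * t) ^ 2 / (2 * t)) = exp (-μ * x) *
      exp (-x ^ 2 / (2 * t) - √(μ ^ 2 + 2 * q) ^ 2 * t / 2) := by
    rw [← exp_add, ← exp_add, sq_sqrt (by positivity)]
    congr 1; field_simp; ring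
  rw [h, abs_of_pos hx, sqrt_mul (by positivity), mul_left_comm, he]
  field_simp

lemma laplace_h {x μ q : ℝ} (hx : 0 < x) (hq : 0 < q) :
    IntegrableOn (fun t => exp (-q * t) * h t x μ) (Ioi 0) ∧
      ∫ t in Ioi (0 : ℝ), exp (-q * t) * h t x μ = exp (-(μ + √(μ ^ 2 + 2 * q)) * x) := by
  have hl : 0 < √(μ ^ 2 + 2 * q) := sqrt_pos.2 (by positivity)
  obtain ⟨hi, he⟩ := laplace_hitting_driftless hx hl
  have heq : EqOn (fun t => exp (-q * t) * h t x μ) _ (Ioi 0) :=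
    fun t ht => exp_mul_h_eq (μ := μ) hx hq ht
  constructor
  · exact (integrableOn_congr_fun heq measurableSet_Ioi).2 (hi.const_mul _)
  · rw [setIntegral_congr_fun measurableSet_Ioi heq, integral_const_mul, he]
    have : √(2 * π) ≠ 0 := by positivity
    rw [div_mul_eq_mul_div, mul_left_comm, mul_div_cancel_left₀ _ this, ← exp_add]
    congr 1; ring

lemma h_nonneg (t x μ : ℝ) : 0 ≤ h t x μ := by
  unfold h; positivity

lemma measurable_h : Measurable fun p : ℝ × ℝ × ℝ => h p.1 p.2.1 p.2.2 := by
  unfold h; fun_prop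

lemma stronglyMeasurable_intervalIntegral_h (α₁ c₁ μ₁ α₂ c₂ μ₂ : ℝ) :
    StronglyMeasurable fun p : ℝ × ℝ => ∫ τ in Ioc 0 p.1,
      h τ (α₁ * p.2 + c₁) μ₁ * h (p.1 - τ) (α₂ * p.2 + c₂) μ₂ := by
  simp_rw [← integral_indicator (measurableSet_Ioc : MeasurableSet (Ioc (0 : ℝ) _))]
  refine StronglyMeasurable.integral_prod_right (Measurable.stronglyMeasurable ?_)
  have h1 : Measurable fun z : (ℝ × ℝ) × ℝ => h z.2 (α₁ * z.1.2 + c₁) μ₁ :=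
    measurable_h.comp (g := fun p : ℝ × ℝ × ℝ => h p.1 p.2.1 p.2.2)
      (f := fun z : (ℝ × ℝ) × ℝ => (z.2, α₁ * z.1.2 + c₁, μ₁)) (by fun_prop)
  have h2 : Measurable fun z : (ℝ × ℝ) × ℝ => h (z.1.1 - z.2) (α₂ * z.1.2 + c₂) μ₂ :=
    measurable_h.comp (g := fun p : ℝ × ℝ × ℝ => h p.1 p.2.1 p.2.2)
      (f := fun z : (ℝ × ℝ) × ℝ => (z.1.1 - z.2, α₂ * z.1.2 + c₂, μ₂)) (by fun_prop)
  have hs : MeasurableSet {z : (ℝ × ℝ) × ℝ | z.2 ∈ Ioc 0 z.1.1} :=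
    (measurableSet_lt measurable_const measurable_snd).inter
      (measurableSet_le measurable_snd measurable_fst.fst)
  exact (h1.mul h2).indicator hs

lemma exp_mul_intervalIntegral_h (q t x₁ μ₁ x₂ μ₂ : ℝ) :
    exp (-q * t) * ∫ τ in (0 : ℝ)..t, h τ x₁ μ₁ * h (t - τ) x₂ μ₂
      = ∫ τ in (0 : ℝ)..t, ContinuousLinearMap.mul ℝ ℝ (exp (-q * τ) * h τ x₁ μ₁)
          (exp (-q * (t - τ)) * h (t - τ) x₂ μ₂) := by
  rw [← intervalIntegral.integral_const_mul]
  congr 1 with τ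
  rw [ContinuousLinearMap.mul_apply', show -q * t = -q * τ + -q * (t - τ) by ring, exp_add]
  ring

lemma laplace_convolution_h {x₁ μ₁ x₂ μ₂ q : ℝ} (hx₁ : 0 < x₁) (hx₂ : 0 < x₂) (hq : 0 < q) :
    IntegrableOn (fun t => exp (-q * t) * ∫ τ in (0 : ℝ)..t, h τ x₁ μ₁ * h (t - τ) x₂ μ₂)
      (Ioi 0) ∧
    ∫ t in Ioi (0 : ℝ), exp (-q * t) * ∫ τ in (0 : ℝ)..t, h τ x₁ μ₁ * h (t - τ) x₂ μ₂
      = exp (-(μ₁ + √(μ₁ ^ 2 + 2 * q)) * x₁) * exp (-(μ₂ + √(μ₂ ^ 2 + 2 * q)) * x₂) := by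
  obtain ⟨hi₁, he₁⟩ := laplace_h (μ := μ₁) hx₁ hq
  obtain ⟨hi₂, he₂⟩ := laplace_h (μ := μ₂) hx₂ hq
  simp_rw [exp_mul_intervalIntegral_h]
  constructor
  · have := integrable_posConvolution hi₁ hi₂ (ContinuousLinearMap.mul ℝ ℝ)
    exact (integrable_indicator_iff measurableSet_Ioi).1 this
  · rw [integral_posConvolution hi₁ hi₂, he₁, he₂, ContinuousLinearMap.mul_apply']

lemma intervalIntegral_h_nonneg {t : ℝ} (ht : 0 ≤ t) (x₁ μ₁ x₂ μ₂ : ℝ) :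
    0 ≤ ∫ τ in (0 : ℝ)..t, h τ x₁ μ₁ * h (t - τ) x₂ μ₂ :=
  intervalIntegral.integral_nonneg_of_forall ht fun _ => mul_nonneg (h_nonneg _ _ _) (h_nonneg _ _ _)

lemma add_sqrt_sq_add_pos (μ : ℝ) {q : ℝ} (hq : 0 < q) : 0 < μ + √(μ ^ 2 + 2 * q) := by
  have : |μ| < √(μ ^ 2 + 2 * q) := lt_sqrt_of_sq_lt (by rw [sq_abs]; linarith)
  linarith [neg_abs_le μ]

lemma laplace_integral_convolution_h {α₁ c₁ μ₁ α₂ c₂ μ₂ q : ℝ} (hα₁ : 0 < α₁) (hc₁ : 0 < c₁)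
    (hα₂ : 0 < α₂) (hc₂ : 0 < c₂) (hq : 0 < q) :
    ∫ t in Ioi (0 : ℝ), exp (-q * t) * ∫ b in Ioi (0 : ℝ), ∫ τ in (0 : ℝ)..t,
        h τ (α₁ * b + c₁) μ₁ * h (t - τ) (α₂ * b + c₂) μ₂
      = exp (-(μ₁ + √(μ₁ ^ 2 + 2 * q)) * c₁) * exp (-(μ₂ + √(μ₂ ^ 2 + 2 * q)) * c₂) /
        (α₁ * (μ₁ + √(μ₁ ^ 2 + 2 * q)) + α₂ * (μ₂ + √(μ₂ ^ 2 + 2 * q))) := by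
  have hk₁ := add_sqrt_sq_add_pos μ₁ hq
  have hk₂ := add_sqrt_sq_add_pos μ₂ hq
  set k₁ := μ₁ + √(μ₁ ^ 2 + 2 * q) with hk₁_def
  set k₂ := μ₂ + √(μ₂ ^ 2 + 2 * q) with hk₂_def
  have hk : 0 < α₁ * k₁ + α₂ * k₂ := by positivity
  have hL : ∀ b ∈ Ioi (0 : ℝ), _ ∧ _ := fun b (hb : 0 < b) =>
    laplace_convolution_h (x₁ := α₁ * b + c₁) (μ₁ := μ₁) (x₂ := α₂ * b + c₂) (μ₂ := μ₂)
      (by positivity) (by positivity) hq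
  have hexp (b : ℝ) : exp (-k₁ * (α₁ * b + c₁)) * exp (-k₂ * (α₂ * b + c₂))
      = exp (-k₁ * c₁) * exp (-k₂ * c₂) * exp (-(α₁ * k₁ + α₂ * k₂) * b) := by
    simp only [← exp_add]; congr 1; ring
  simp_rw [← hk₁_def, ← hk₂_def, hexp] at hL
  let F : ℝ → ℝ → ℝ := fun t b => exp (-q * t) * ∫ τ in (0 : ℝ)..t,
    h τ (α₁ * b + c₁) μ₁ * h (t - τ) (α₂ * b + c₂) μ₂
  have hint : Integrable (Function.uncurry F)
      ((volume.restrict (Ioi 0)).prod (volume.restrict (Ioi 0))) := by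
    have hmeas : AEStronglyMeasurable (Function.uncurry F)
        ((volume.restrict (Ioi 0)).prod (volume.restrict (Ioi 0))) := by
      have hm : AEStronglyMeasurable (fun p : ℝ × ℝ => exp (-q * p.1) * ∫ τ in Ioc 0 p.1,
          h τ (α₁ * p.2 + c₁) μ₁ * h (p.1 - τ) (α₂ * p.2 + c₂) μ₂)
          ((volume.restrict (Ioi 0)).prod (volume.restrict (Ioi 0))) :=
        (Continuous.aestronglyMeasurable (by fun_prop)).mul
          (stronglyMeasurable_intervalIntegral_h α₁ c₁ μ₁ α₂ c₂ μ₂).aestronglyMeasurable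
      refine hm.congr ?_
      rw [Measure.prod_restrict]
      filter_upwards [ae_restrict_mem (measurableSet_Ioi.prod measurableSet_Ioi)] with p hp
      simp only [Function.uncurry, F]
      rw [intervalIntegral.integral_of_le (le_of_lt hp.1)]
    rw [integrable_prod_iff' hmeas]
    constructor
    · filter_upwards [ae_restrict_mem measurableSet_Ioi] with b hb using (hL b hb).1
    · refine ((integrableOn_exp_mul_Ioi (neg_neg_of_pos hk) 0).const_mul
        (exp (-k₁ * c₁) * exp (-k₂ * c₂))).congr ?_
      filter_upwards [ae_restrict_mem measurableSet_Ioi] with b hb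
      rw [← (hL b hb).2]
      refine setIntegral_congr_fun measurableSet_Ioi fun t ht => ?_
      exact (norm_of_nonneg (mul_nonneg (exp_pos _).le
        (intervalIntegral_h_nonneg (le_of_lt ht) _ _ _ _))).symm
  calc _ = ∫ t in Ioi (0 : ℝ), ∫ b in Ioi (0 : ℝ), F t b := by
        simp only [F, integral_const_mul]
    _ = ∫ b in Ioi (0 : ℝ), ∫ t in Ioi (0 : ℝ), F t b := integral_integral_swap hint
    _ = ∫ b in Ioi (0 : ℝ), exp (-k₁ * c₁) * exp (-k₂ * c₂) * exp (-(α₁ * k₁ + α₂ * k₂) * b) :=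
        setIntegral_congr_fun measurableSet_Ioi fun b hb => (hL b hb).2
    _ = _ := by
        rw [integral_const_mul, integral_exp_mul_Ioi (neg_neg_of_pos hk)]
        rw [mul_zero, exp_zero, neg_div_neg_eq, mul_one_div]

/-- Laplace transform in `t` of the transition density of refracted skew Brownian motion
for `x < 0` and `y > 0`. -/
theorem laplace_p_xneg_ypos (β μp μm q x y : ℝ)
    (hβ : β ∈ Ioo (-1 : ℝ) 1) (hq : 0 < q) (hx : x < 0) (hy : 0 < y) :
    ∫ t in Ioi (0 : ℝ), Real.exp (-q * t) *
        (2 * (1 + β) * Real.exp (2 * μp * y) *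
          ∫ b in Ioi (0 : ℝ), ∫ τ in (0 : ℝ)..t,
            h τ ((1 + β) * b + y) μp * h (t - τ) ((1 - β) * b - x) (-μm))
      = 2 * (1 + β) / D β μp μm q *
          Real.exp ((-μm + Real.sqrt (μm ^ 2 + 2 * q)) * x) *
          Real.exp ((μp - Real.sqrt (μp ^ 2 + 2 * q)) * y) := by
  simp_rw [mul_left_comm (exp (-q * _)), sub_eq_add_neg (_ * _) x]
  rw [integral_const_mul, laplace_integral_convolution_h (by linarith [hβ.1]) hy
    (by linarith [hβ.2]) (neg_pos.2 hx) hq, neg_sq, D, add_comm (2 * q), add_comm (2 * q)]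
  have hE : exp ((μp - √(μp ^ 2 + 2 * q)) * y)
      = exp (2 * μp * y) * exp (-(μp + √(μp ^ 2 + 2 * q)) * y) := by
    rw [← exp_add]; congr 1; ring
  rw [hE, neg_mul_neg]
  ring
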